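/- arXiv:1705.03744 — 5 statements merged into one kernel-verified Lean document; each statement's English description precedes it below -/
import Mathlib

section
/- Let g : ℝ → ℝ be continuous with g(σ) > 0 for every σ ∈ [0,1], and set c = ∫₀¹ √(g(σ)) dσ. Suppose x* : [0,1] → ℝ is differentiable with x*(0) = 0, x*(1) = 1, x*(t) ∈ [0,1] for all t, and satisfies the first-order condition (dx*/dt)(t) = c / √(g(x*(t))) for all t ∈ [0,1]. Then x* is a global minimizer of the reparameterization cost: for every continuously differentiable, monotone nondecreasing y : [0,1] → ℝ with y(0) = 0, y(1) = 1 and y(t) ∈ [0,1] for all t, one has ∫₀¹ g(x*(t)) (dx*/dt)(t)² dt ≤ ∫₀¹ g(y(t)) (dy/dt)(t)² dt. -/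
open Set intervalIntegral

/-- The solution `x*` of the integrated Euler–Lagrange equation
`ẋ = c / √(g x)` with `c = ∫₀¹ √(g σ) dσ` globally minimizes the reparameterization
cost `J(y) = ∫₀¹ g(y) ẏ² dt` over all C¹ monotone nondecreasing `y : [0,1] → [0,1]`
with `y 0 = 0`, `y 1 = 1`. -/
theorem globally_optimal_reparameterization
    (g : ℝ → ℝ) (hg : Continuous g)
    (hgpos : ∀ σ ∈ Icc (0:ℝ) 1, 0 < g σ)
    (c : ℝ) (hc : c = ∫ σ in (0:ℝ)..1, Real.sqrt (g σ))
    (x : ℝ → ℝ)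
    (hxdiff : ∀ t ∈ Icc (0:ℝ) 1, DifferentiableAt ℝ x t)
    (hx0 : x 0 = 0) (hx1 : x 1 = 1)
    (hxmem : ∀ t ∈ Icc (0:ℝ) 1, x t ∈ Icc (0:ℝ) 1)
    (hode : ∀ t ∈ Icc (0:ℝ) 1, deriv x t = c / Real.sqrt (g (x t))) :
    ∀ y : ℝ → ℝ, ContDiff ℝ 1 y → MonotoneOn y (Icc (0:ℝ) 1) →
      y 0 = 0 → y 1 = 1 → (∀ t ∈ Icc (0:ℝ) 1, y t ∈ Icc (0:ℝ) 1) →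
      (∫ t in (0:ℝ)..1, g (x t) * (deriv x t) ^ 2) ≤
        ∫ t in (0:ℝ)..1, g (y t) * (deriv y t) ^ 2 := by
  intro y hy _ hy0 hy1 hymem
  have hy' : Continuous (deriv y) := hy.continuous_deriv le_rfl
  have hsubst : ∫ t in (0:ℝ)..1, Real.sqrt (g (y t)) * deriv y t = c := by
    have h := integral_comp_mul_deriv (a := 0) (b := 1) (f := y) (f' := deriv y)
      (g := fun σ => Real.sqrt (g σ))
      (fun t _ => (hy.differentiable one_ne_zero t).hasDerivAt)
      hy'.continuousOn hg.sqrt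
    rw [hy0, hy1] at h
    exact h.trans hc.symm
  have hconst : ∫ t in (0:ℝ)..1, g (x t) * (deriv x t) ^ 2 = c ^ 2 := by
    have h : EqOn (fun t => g (x t) * (deriv x t) ^ 2) (fun _ => c ^ 2) (uIcc 0 1) := by
      intro t ht
      rw [uIcc_of_le zero_le_one] at ht
      have hpos := hgpos _ (hxmem t ht)
      simp only [hode t ht, div_pow, Real.sq_sqrt hpos.le]
      field_simp
    rw [integral_congr h]
    simp
  have hu : Continuous fun t => Real.sqrt (g (y t)) * deriv y t :=
    (hg.comp hy.continuous).sqrt.mul hy'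
  calc ∫ t in (0:ℝ)..1, g (x t) * (deriv x t) ^ 2
      = ∫ t in (0:ℝ)..1, (2 * c * (Real.sqrt (g (y t)) * deriv y t) - c ^ 2) := by
        rw [hconst, integral_sub ((hu.const_mul (2 * c)).intervalIntegrable 0 1)
          (continuous_const.intervalIntegrable 0 1), integral_const_mul, hsubst]
        simp
        ring
    _ ≤ ∫ t in (0:ℝ)..1, g (y t) * (deriv y t) ^ 2 := by
        refine integral_mono_on zero_le_one
          (((hu.const_mul (2 * c)).sub continuous_const).intervalIntegrable 0 1)
          (((hg.comp hy.continuous).mul (hy'.pow 2)).intervalIntegrable 0 1) fun t ht => ?_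
        have hsq := Real.sq_sqrt (hgpos _ (hymem t ht)).le
        have h := sq_nonneg (Real.sqrt (g (y t)) * deriv y t - c)
        rw [sub_sq, mul_pow, hsq] at h
        linarith
end

section
/- Let n, m be positive integers, let f : ℝⁿ × ℝⁿ × ℝ → ℝ be continuous, and fix x₀, x₁ ∈ ℝⁿ and s₀, s₁ ∈ ℝᵐ. Let A : ℝⁿ → (m × n real matrices) be continuously differentiable and satisfy the symmetry condition ∂A_{ji}/∂x_k = ∂A_{jk}/∂x_i at every point of ℝⁿ, for all i, k ∈ {1,…,n} and j ∈ {1,…,m}. Let W : [0,1] → (m × m real matrices) be continuous with W(t) symmetric positive definite for every t. Define the composite integrand φ(x, ẋ, s, ṡ, t) = f(x, ẋ, t) + ½ (ṡ − A(x)ẋ)ᵀ W(t) (ṡ − A(x)ẋ). Suppose x* : [0,1] → ℝⁿ is continuously differentiable with x*(0) = x₀, x*(1) = x₁, and ∫₀¹ f(x*(t), ẋ*(t), t) dt ≤ ∫₀¹ f(x(t), ẋ(t), t) dt for every continuously differentiable x : [0,1] → ℝⁿ with x(0) = x₀ and x(1) = x₁. Suppose s* : [0,1] → ℝᵐ is continuously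 differentiable with s*(0) = s₀, s*(1) = s₁, and there exists a constant vector a ∈ ℝᵐ such that ṡ*(t) = W(t)⁻¹ a + A(x*(t)) ẋ*(t) for all t ∈ [0,1]. Then for every pair of continuously differentiable curves x : [0,1] → ℝⁿ and s : [0,1] → ℝᵐ with x(0) = x₀, x(1) = x₁, s(0) = s₀, s(1) = s₁, one has ∫₀¹ φ(x*(t), ẋ*(t), s*(t), ṡ*(t), t) dt ≤ ∫₀¹ φ(x(t), ẋ(t), s(t), ṡ(t), t) dt. -/
open Set Matrix intervalIntegral

/-- A `C¹` row field with symmetric partial derivatives is a gradient. -/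
theorem exists_hasFDerivAt_of_partialDeriv_symm {ι : Type*} [Fintype ι] [DecidableEq ι]
    {a : (ι → ℝ) → ι → ℝ} (ha : ∀ i, Differentiable ℝ fun p => a p i)
    (hsymm : ∀ p i k, fderiv ℝ (fun q => a q i) p (Pi.single k 1) =
      fderiv ℝ (fun q => a q k) p (Pi.single i 1)) :
    ∃ g : (ι → ℝ) → ℝ, ∀ p,
      HasFDerivAt g (∑ i, a p i • ContinuousLinearMap.proj (R := ℝ) (φ := fun _ : ι => ℝ) i) p := by
  have hderiv : ∀ p, HasFDerivAt
      (fun q => ∑ i, a q i • ContinuousLinearMap.proj (R := ℝ) (φ := fun _ : ι => ℝ) i)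
      (∑ i, (fderiv ℝ (fun q => a q i) p).smulRight
        (ContinuousLinearMap.proj (R := ℝ) (φ := fun _ : ι => ℝ) i)) p := fun p =>
    HasFDerivAt.fun_sum fun i _ => (ha i p).hasFDerivAt.smul_const
      (ContinuousLinearMap.proj (R := ℝ) (φ := fun _ : ι => ℝ) i)
  have hexpand : ∀ (L : (ι → ℝ) →L[ℝ] ℝ) (u : ι → ℝ), L u = ∑ k, u k * L (Pi.single k 1) := by
    intro L u
    conv_lhs => rw [pi_eq_sum_univ' u]
    simp [map_sum]
  obtain ⟨g, hg⟩ := convex_univ.exists_forall_hasFDerivAt_of_fderiv_symmetric isOpen_univ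
    (fun p _ => (hderiv p).differentiableAt.differentiableWithinAt) (fun p _ u v => by
      rw [(hderiv p).fderiv]
      simp only [_root_.sum_apply, ContinuousLinearMap.smulRight_apply,
        _root_.smul_apply, ContinuousLinearMap.proj_apply, smul_eq_mul]
      simp_rw [hexpand _ u, hexpand _ v, Finset.sum_mul]
      rw [Finset.sum_comm]
      refine Finset.sum_congr rfl fun k _ => Finset.sum_congr rfl fun i _ => ?_
      rw [hsymm p i k]
      ring)
  exact ⟨g, fun p => hg p (mem_univ p)⟩

/-- The integral of a matrix field with symmetric partial derivatives along a `C¹` curve depends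
only on the endpoints of the curve. -/
theorem exists_integral_mulVec_deriv_eq_sub {n m : ℕ}
    {A : (Fin n → ℝ) → Matrix (Fin m) (Fin n) ℝ}
    (hA : ∀ j i, ContDiff ℝ 1 fun p => A p j i)
    (hAsym : ∀ p i k j, fderiv ℝ (fun q => A q j i) p (Pi.single k 1) =
      fderiv ℝ (fun q => A q j k) p (Pi.single i 1)) (j : Fin m) :
    ∃ g : (Fin n → ℝ) → ℝ, ∀ x : ℝ → Fin n → ℝ, ContDiff ℝ 1 x → ∀ b c : ℝ,
      ∫ t in b..c, (A (x t) *ᵥ deriv x t) j = g (x c) - g (x b) := by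
  obtain ⟨g, hg⟩ := exists_hasFDerivAt_of_partialDeriv_symm (a := fun p => A p j)
    (fun i => (hA j i).differentiable one_ne_zero) (fun p i k => hAsym p i k j)
  refine ⟨g, fun x hx b c => ?_⟩
  have hx' : Continuous (deriv x) := hx.continuous_deriv le_rfl
  have hcont : Continuous fun t => (A (x t) *ᵥ deriv x t) j := by
    simp only [Matrix.mulVec, dotProduct]
    exact continuous_finsetSum _ fun i _ =>
      ((hA j i).continuous.comp hx.continuous).mul (continuous_pi_iff.1 hx' i)
  refine integral_eq_sub_of_hasDerivAt (f := g ∘ x) (fun t _ => ?_) (hcont.intervalIntegrable _ _)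
  convert (hg (x t)).comp_hasDerivAt t (hx.differentiable one_ne_zero t).hasDerivAt using 1
  simp [Matrix.mulVec, dotProduct]

/-- The tangent inequality for the convex quadratic form of a positive semidefinite matrix. -/
theorem Matrix.PosSemidef.half_dotProduct_mulVec_add_le {ι : Type*} [Fintype ι]
    {M : Matrix ι ι ℝ} (hM : M.PosSemidef) (u v : ι → ℝ) :
    (1 / 2) * (v ⬝ᵥ (M *ᵥ v)) + (M *ᵥ v) ⬝ᵥ (u - v) ≤ (1 / 2) * (u ⬝ᵥ (M *ᵥ u)) := by
  have hnonneg : 0 ≤ (u - v) ⬝ᵥ (M *ᵥ (u - v)) := by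
    simpa using hM.dotProduct_mulVec_nonneg (u - v)
  have hsymm : v ⬝ᵥ (M *ᵥ u) = u ⬝ᵥ (M *ᵥ v) := by
    have htrans : Mᵀ = M := by simpa using hM.isHermitian.eq
    rw [dotProduct_mulVec, ← mulVec_transpose, htrans, dotProduct_comm]
  simp only [mulVec_sub, sub_dotProduct, dotProduct_sub] at hnonneg ⊢
  rw [dotProduct_comm (M *ᵥ v) u, dotProduct_comm (M *ᵥ v) v]
  linarith

/-- **Bootstrapping theorem.** If `x*` globally minimizes
`∫₀¹ f(x, ẋ, t) dt` among C¹ curves with fixed endpoints, `A : ℝⁿ → ℝ^{m×n}` is C¹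
and satisfies `∂A_{ji}/∂x_k = ∂A_{jk}/∂x_i`, `W(t)` is symmetric positive definite,
and `s*` satisfies `ṡ* = W⁻¹ a + A(x*) ẋ*` for a constant vector `a`, then
`(x*, s*)` globally minimizes the composite cost with integrand
`φ = f(x, ẋ, t) + ½ ‖ṡ − A(x) ẋ‖²_{W(t)}` among curves with the same endpoints. -/
theorem bootstrapping_global_optimality
    (n m : ℕ) (hn : 0 < n) (hm : 0 < m)
    (f : (Fin n → ℝ) × (Fin n → ℝ) × ℝ → ℝ) (hf : Continuous f)
    (x₀ x₁ : Fin n → ℝ) (s₀ s₁ : Fin m → ℝ)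
    (A : (Fin n → ℝ) → Matrix (Fin m) (Fin n) ℝ)
    (hA : ∀ (j : Fin m) (i : Fin n), ContDiff ℝ 1 fun p => A p j i)
    (hAsym : ∀ (p : Fin n → ℝ) (i k : Fin n) (j : Fin m),
      fderiv ℝ (fun q => A q j i) p (Pi.single k 1) =
        fderiv ℝ (fun q => A q j k) p (Pi.single i 1))
    (W : ℝ → Matrix (Fin m) (Fin m) ℝ) (hW : ContinuousOn W (Icc (0:ℝ) 1))
    (hWpd : ∀ t ∈ Icc (0:ℝ) 1, (W t).PosDef)
    (xs : ℝ → Fin n → ℝ) (hxs : ContDiff ℝ 1 xs)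
    (hxs0 : xs 0 = x₀) (hxs1 : xs 1 = x₁)
    (hxsopt : ∀ x : ℝ → Fin n → ℝ, ContDiff ℝ 1 x → x 0 = x₀ → x 1 = x₁ →
      (∫ t in (0:ℝ)..1, f (xs t, deriv xs t, t)) ≤
        ∫ t in (0:ℝ)..1, f (x t, deriv x t, t))
    (ss : ℝ → Fin m → ℝ) (hss : ContDiff ℝ 1 ss)
    (hss0 : ss 0 = s₀) (hss1 : ss 1 = s₁)
    (hssode : ∃ a : Fin m → ℝ, ∀ t ∈ Icc (0:ℝ) 1,
      deriv ss t = (W t)⁻¹ *ᵥ a + A (xs t) *ᵥ deriv xs t) :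
    ∀ (x : ℝ → Fin n → ℝ) (s : ℝ → Fin m → ℝ),
      ContDiff ℝ 1 x → ContDiff ℝ 1 s →
      x 0 = x₀ → x 1 = x₁ → s 0 = s₀ → s 1 = s₁ →
      (∫ t in (0:ℝ)..1, (f (xs t, deriv xs t, t) +
          (1 / 2) * ((deriv ss t - A (xs t) *ᵥ deriv xs t) ⬝ᵥ
            (W t *ᵥ (deriv ss t - A (xs t) *ᵥ deriv xs t))))) ≤
        ∫ t in (0:ℝ)..1, (f (x t, deriv x t, t) +
          (1 / 2) * ((deriv s t - A (x t) *ᵥ deriv x t) ⬝ᵥ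
            (W t *ᵥ (deriv s t - A (x t) *ᵥ deriv x t)))) := by
  intro x s hx hs hx0 hx1 hs0 hs1
  obtain ⟨a, ha⟩ := hssode
  have hAc : Continuous A :=
    continuous_pi fun j => continuous_pi fun i => (hA j i).continuous
  have hcurve : ∀ {k : ℕ} {y : ℝ → Fin k → ℝ}, ContDiff ℝ 1 y → Continuous (deriv y) :=
    fun hy => hy.continuous_deriv le_rfl
  have hres : ∀ {y : ℝ → Fin n → ℝ} {r : ℝ → Fin m → ℝ}, ContDiff ℝ 1 y → ContDiff ℝ 1 r →
      Continuous fun t => deriv r t - A (y t) *ᵥ deriv y t := fun hy hr =>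
    (hcurve hr).sub ((hAc.comp hy.continuous).matrix_mulVec (hcurve hy))
  have hlagr : ∀ {y : ℝ → Fin n → ℝ}, ContDiff ℝ 1 y →
      IntervalIntegrable (fun t => f (y t, deriv y t, t)) MeasureTheory.volume 0 1 := fun hy =>
    (hf.comp (hy.continuous.prodMk ((hcurve hy).prodMk continuous_id))).intervalIntegrable _ _
  have hquad : ∀ {u : ℝ → Fin m → ℝ}, Continuous u →
      IntervalIntegrable (fun t => (1 / 2) * (u t ⬝ᵥ (W t *ᵥ u t))) MeasureTheory.volume 0 1 := by
    intro u hu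
    refine ContinuousOn.intervalIntegrable_of_Icc zero_le_one (continuousOn_const.mul ?_)
    rw [continuousOn_iff_continuous_domRestrict] at hW ⊢
    have hu' : Continuous fun t : Icc (0 : ℝ) 1 => u t := hu.comp continuous_subtype_val
    exact hu'.dotProduct (hW.matrix_mulVec hu')
  have hresEq : ∀ j, ∫ t in (0 : ℝ)..1, (deriv s t - A (x t) *ᵥ deriv x t) j =
      ∫ t in (0 : ℝ)..1, (deriv ss t - A (xs t) *ᵥ deriv xs t) j := by
    intro j
    obtain ⟨g, hg⟩ := exists_integral_mulVec_deriv_eq_sub hA hAsym j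
    have hval : ∀ {y : ℝ → Fin n → ℝ} {r : ℝ → Fin m → ℝ}, ContDiff ℝ 1 y → ContDiff ℝ 1 r →
        ∫ t in (0 : ℝ)..1, (deriv r t - A (y t) *ᵥ deriv y t) j =
          r 1 j - r 0 j - (g (y 1) - g (y 0)) := by
      intro y r hy hr
      have hrj : Continuous fun t => deriv r t j := continuous_pi_iff.1 (hcurve hr) j
      have hyj : Continuous fun t => (A (y t) *ᵥ deriv y t) j :=
        continuous_pi_iff.1 ((hAc.comp hy.continuous).matrix_mulVec (hcurve hy)) j
      simp only [Pi.sub_apply]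
      rw [integral_sub (hrj.intervalIntegrable _ _) (hyj.intervalIntegrable _ _), hg y hy,
        integral_eq_sub_of_hasDerivAt (f := fun t => r t j) (fun t _ =>
          hasDerivAt_pi.1 (hr.differentiable one_ne_zero t).hasDerivAt j)
          (hrj.intervalIntegrable _ _)]
    rw [hval hx hs, hval hxs hss, hx0, hx1, hs0, hs1, hxs0, hxs1, hss0, hss1]
  have hu := hres hx hs
  have hv := hres hxs hss
  set u := fun t => deriv s t - A (x t) *ᵥ deriv x t
  set v := fun t => deriv ss t - A (xs t) *ᵥ deriv xs t
  have hWv : ∀ t ∈ Icc (0 : ℝ) 1, W t *ᵥ v t = a := by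
    intro t ht
    simp only [v, ha t ht, add_sub_cancel_right, mulVec_mulVec]
    rw [mul_nonsing_inv _ ((isUnit_iff_isUnit_det _).1 (hWpd t ht).isUnit), one_mulVec]
  have hlin : IntervalIntegrable (fun t => a ⬝ᵥ (u t - v t)) MeasureTheory.volume 0 1 :=
    (continuous_const.dotProduct (hu.sub hv)).intervalIntegrable _ _
  have hlin_zero : ∫ t in (0 : ℝ)..1, a ⬝ᵥ (u t - v t) = 0 := by
    have huj : ∀ j, Continuous fun t => u t j := continuous_pi_iff.1 hu
    have hvj : ∀ j, Continuous fun t => v t j := continuous_pi_iff.1 hv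
    simp only [dotProduct, Pi.sub_apply]
    have hterm : ∀ j ∈ Finset.univ,
        IntervalIntegrable (fun t => a j * (u t j - v t j)) MeasureTheory.volume 0 1 := fun j _ =>
      (continuous_const.mul ((huj j).sub (hvj j))).intervalIntegrable _ _
    rw [integral_finsetSum hterm]
    refine Finset.sum_eq_zero fun j _ => ?_
    rw [integral_const_mul, integral_sub ((huj j).intervalIntegrable _ _)
      ((hvj j).intervalIntegrable _ _), hresEq j, sub_self, mul_zero]
  have hcoupling := integral_mono_on zero_le_one ((hquad hv).add hlin) (hquad hu) fun t ht => by
    simpa only [hWv t ht] using (hWpd t ht).posSemidef.half_dotProduct_mulVec_add_le (u t) (v t)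
  rw [integral_add (hquad hv) hlin, hlin_zero, add_zero] at hcoupling
  rw [integral_add (hlagr hxs) (hquad hv), integral_add (hlagr hx) (hquad hu)]
  exact add_le_add (hxsopt x hx hx0 hx1) hcoupling
end

section
/- Let m be a positive integer, let W : [0,1] → (m × m real matrices) be continuous with W(t) symmetric positive definite for every t, let u : [0,1] → ℝᵐ be continuous, and fix s₀, s₁ ∈ ℝᵐ. Suppose s* : [0,1] → ℝᵐ is continuously differentiable with s*(0) = s₀, s*(1) = s₁, and there exists a constant vector a ∈ ℝᵐ such that ṡ*(t) = W(t)⁻¹ a + u(t) for all t ∈ [0,1]. Then for every continuously differentiable s : [0,1] → ℝᵐ with s(0) = s₀ and s(1) = s₁, one has ∫₀¹ ½ (ṡ*(t) − u(t))ᵀ W(t) (ṡ*(t) − u(t)) dt ≤ ∫₀¹ ½ (ṡ(t) − u(t))ᵀ W(t) (ṡ(t) − u(t)) dt. -/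
open Set Matrix intervalIntegral

/-- The convexity inequality `f p + ⟨A p, q - p⟩ ≤ f q` for the quadratic form
`f v = ½ vᵀ A v` of a positive semidefinite matrix `A`. -/
lemma Matrix.PosSemidef.half_quadratic_add_le {n : Type*} [Fintype n] {A : Matrix n n ℝ}
    (hA : A.PosSemidef) (p q : n → ℝ) :
    (1 / 2) * (p ⬝ᵥ (A *ᵥ p)) + (A *ᵥ p) ⬝ᵥ (q - p) ≤ (1 / 2) * (q ⬝ᵥ (A *ᵥ q)) := by
  have hsymm : p ⬝ᵥ (A *ᵥ q) = q ⬝ᵥ (A *ᵥ p) := by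
    have hT : Aᵀ = A := by simpa [conjTranspose_eq_transpose_of_trivial] using hA.isHermitian.eq
    rw [dotProduct_mulVec, ← mulVec_transpose, hT, dotProduct_comm]
  have hnonneg : 0 ≤ (q - p) ⬝ᵥ (A *ᵥ (q - p)) := by
    simpa using hA.dotProduct_mulVec_nonneg (q - p)
  rw [dotProduct_comm (A *ᵥ p)]
  simp only [mulVec_sub, dotProduct_sub, sub_dotProduct] at hnonneg ⊢
  linarith

lemma ContinuousOn.half_quadratic {n : Type*} [Fintype n] {S : Set ℝ}
    {A : ℝ → Matrix n n ℝ} {v : ℝ → n → ℝ} (hA : ContinuousOn A S) (hv : ContinuousOn v S) :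
    ContinuousOn (fun t => (1 / 2) * (v t ⬝ᵥ (A t *ᵥ v t))) S := by
  rw [continuousOn_iff_continuous_domRestrict] at *
  exact continuous_const.mul (hv.dotProduct (hA.matrix_mulVec hv))

/-- Two C¹ curves with the same endpoints have the same mean velocity in every direction. -/
lemma integral_dotProduct_deriv_sub_eq_zero {n : Type*} [Fintype n] {c d : ℝ} (a : n → ℝ)
    {f g : ℝ → n → ℝ} (hf : ContDiff ℝ 1 f) (hg : ContDiff ℝ 1 g)
    (hc : f c = g c) (hd : f d = g d) :
    ∫ t in c..d, a ⬝ᵥ (deriv f t - deriv g t) = 0 := by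
  have hderiv : ∀ t, HasDerivAt (fun t => a ⬝ᵥ (f t - g t)) (a ⬝ᵥ (deriv f t - deriv g t)) t := by
    intro t
    have hsub := ((hf.differentiable one_ne_zero t).hasDerivAt).sub
      ((hg.differentiable one_ne_zero t).hasDerivAt)
    exact HasDerivAt.fun_sum fun i _ => (hasDerivAt_pi.1 hsub i).const_mul (a i)
  rw [integral_eq_sub_of_hasDerivAt (fun t _ => hderiv t)]
  · simp [hc, hd]
  · exact (continuous_const.dotProduct ((hf.continuous_deriv le_rfl).sub
      (hg.continuous_deriv le_rfl))).intervalIntegrable _ _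

/-- For the cost `∫₀¹ ½ ‖ṡ − u(t)‖²_{W(t)} dt` with `W(t)`
symmetric positive definite, the C¹ curve `s*` whose velocity satisfies
`ṡ* = W⁻¹ a + u` for a constant vector `a` globally minimizes the cost among all
C¹ curves with the same endpoint values. -/
theorem s_part_global_minimum
    (m : ℕ) (hm : 0 < m)
    (W : ℝ → Matrix (Fin m) (Fin m) ℝ) (hW : ContinuousOn W (Icc (0:ℝ) 1))
    (hWpd : ∀ t ∈ Icc (0:ℝ) 1, (W t).PosDef)
    (u : ℝ → Fin m → ℝ) (hu : ContinuousOn u (Icc (0:ℝ) 1))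
    (s₀ s₁ : Fin m → ℝ)
    (ss : ℝ → Fin m → ℝ) (hss : ContDiff ℝ 1 ss)
    (hss0 : ss 0 = s₀) (hss1 : ss 1 = s₁)
    (hode : ∃ a : Fin m → ℝ, ∀ t ∈ Icc (0:ℝ) 1, deriv ss t = (W t)⁻¹ *ᵥ a + u t) :
    ∀ s : ℝ → Fin m → ℝ, ContDiff ℝ 1 s → s 0 = s₀ → s 1 = s₁ →
      (∫ t in (0:ℝ)..1,
          (1 / 2) * ((deriv ss t - u t) ⬝ᵥ (W t *ᵥ (deriv ss t - u t)))) ≤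
        ∫ t in (0:ℝ)..1,
          (1 / 2) * ((deriv s t - u t) ⬝ᵥ (W t *ᵥ (deriv s t - u t))) := by
  obtain ⟨a, ha⟩ := hode
  intro s hs hs0 hs1
  have hds := hs.continuous_deriv le_rfl
  have hdss := hss.continuous_deriv le_rfl
  have hmomentum : ∀ t ∈ Icc (0:ℝ) 1, W t *ᵥ (deriv ss t - u t) = a := by
    intro t ht
    rw [ha t ht, add_sub_cancel_right, mulVec_mulVec,
      mul_nonsing_inv _ ((isUnit_iff_isUnit_det _).1 (hWpd t ht).isUnit), one_mulVec]
  have hcost : ∀ r : ℝ → Fin m → ℝ, Continuous r → IntervalIntegrable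
      (fun t => (1 / 2) * ((r t - u t) ⬝ᵥ (W t *ᵥ (r t - u t)))) MeasureTheory.volume 0 1 :=
    fun r hr => (hW.half_quadratic (hr.continuousOn.sub hu)).intervalIntegrable_of_Icc zero_le_one
  have hlin : IntervalIntegrable (fun t => a ⬝ᵥ (deriv s t - deriv ss t))
      MeasureTheory.volume 0 1 :=
    (continuous_const.dotProduct (hds.sub hdss)).intervalIntegrable _ _
  have hzero := integral_dotProduct_deriv_sub_eq_zero a hs hss
    (hs0.trans hss0.symm) (hs1.trans hss1.symm)
  have hle := integral_mono_on zero_le_one ((hcost _ hdss).add hlin) (hcost _ hds) fun t ht => by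
    have hconvex :=
      (hWpd t ht).posSemidef.half_quadratic_add_le (deriv ss t - u t) (deriv s t - u t)
    simpa only [sub_sub_sub_cancel_right, hmomentum t ht] using hconvex
  simpa only [integral_add (hcost _ hdss) hlin, hzero, add_zero] using hle
end

section
/- Let N be a positive integer, let M : [0,1] → (N × N real matrices) be continuous with M(τ) symmetric positive definite for every τ ∈ [0,1], let b : [0,1] → ℝᴺ and c : [0,1] → ℝ be continuous, define 𝔤₂(τ) = ½ (c(τ) − b(τ)ᵀ M(τ)⁻¹ b(τ)), and assume 𝔤₂(τ) > 0 for all τ ∈ [0,1]. Then for every continuous ξ : [0,1] → ℝᴺ and every continuously differentiable, monotone nondecreasing τ : [0,1] → ℝ with τ(0) = 0, τ(1) = 1 and τ(t) ∈ [0,1] for all t, one has ∫₀¹ { ½ ξ(t)ᵀ M(τ(t)) ξ(t) − ξ(t)ᵀ b(τ(t)) τ̇(t) + ½ c(τ(t)) τ̇(t)² } dt ≥ (∫₀¹ √(𝔤₂(σ)) dσ)². -/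
open Set Matrix intervalIntegral

theorem quadratic_completion_le {n : Type*} [Fintype n] [DecidableEq n]
    {A : Matrix n n ℝ} (hA : A.PosDef) (v w : n → ℝ) (c r : ℝ) :
    (1 / 2) * (c - w ⬝ᵥ (A⁻¹ *ᵥ w)) * r ^ 2 ≤
      (1 / 2) * (v ⬝ᵥ (A *ᵥ v)) - (v ⬝ᵥ w) * r + (1 / 2) * c * r ^ 2 := by
  have hdet : IsUnit A.det := hA.det_pos.ne'.isUnit
  have hcancel : A *ᵥ (A⁻¹ *ᵥ w) = w := by
    rw [mulVec_mulVec, mul_nonsing_inv _ hdet, one_mulVec]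
  have hsymm : Aᵀ = A := by simpa [IsHermitian] using hA.isHermitian
  have hcross : (A⁻¹ *ᵥ w) ⬝ᵥ (A *ᵥ v) = v ⬝ᵥ w := by
    rw [dotProduct_mulVec, ← mulVec_transpose, hsymm, hcancel, dotProduct_comm]
  have hnonneg : 0 ≤ (v - r • (A⁻¹ *ᵥ w)) ⬝ᵥ (A *ᵥ (v - r • (A⁻¹ *ᵥ w))) := by
    simpa using hA.posSemidef.dotProduct_mulVec_nonneg (v - r • (A⁻¹ *ᵥ w))
  rw [mulVec_sub, mulVec_smul, hcancel] at hnonneg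
  simp only [sub_dotProduct, dotProduct_sub, smul_dotProduct, dotProduct_smul, hcross,
    smul_eq_mul, dotProduct_comm (A⁻¹ *ᵥ w) w] at hnonneg
  nlinarith [hnonneg]

theorem continuousOn_matrix_inv {X n : Type*} [TopologicalSpace X] [Fintype n] [DecidableEq n]
    {A : X → Matrix n n ℝ} {s : Set X} (hA : ContinuousOn A s)
    (hdet : ∀ x ∈ s, (A x).det ≠ 0) : ContinuousOn (fun x => (A x)⁻¹) s := by
  rw [continuousOn_iff_continuous_domRestrict] at hA ⊢
  have heq : s.domRestrict (fun x => (A x)⁻¹) =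
      fun x => (s.domRestrict A x).det⁻¹ • (s.domRestrict A x).adjugate := by
    ext1 x
    simp [Matrix.inv_def, Set.domRestrict]
  rw [heq]
  exact (hA.matrix_det.inv₀ fun x => hdet x x.2).smul hA.matrix_adjugate

theorem continuousOn_dotProduct_mulVec {X n : Type*} [TopologicalSpace X] [Fintype n]
    {A : X → Matrix n n ℝ} {v w : X → n → ℝ} {s : Set X} (hA : ContinuousOn A s)
    (hv : ContinuousOn v s) (hw : ContinuousOn w s) :
    ContinuousOn (fun x => v x ⬝ᵥ (A x *ᵥ w x)) s := by
  rw [continuousOn_iff_continuous_domRestrict] at *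
  exact hv.dotProduct (hA.matrix_mulVec hw)

/-- The joint cost over an unconstrained group-velocity curve
`ξ` and a C¹ monotone time reparameterization `τ : [0,1] → [0,1]` with
`τ 0 = 0`, `τ 1 = 1` is bounded below by `(∫₀¹ √(𝔤₂ σ) dσ)²`, where
`𝔤₂(τ) = ½ (c(τ) − b(τ)ᵀ M(τ)⁻¹ b(τ))`. -/
theorem joint_minimization_lower_bound
    (N : ℕ) (hN : 0 < N)
    (M : ℝ → Matrix (Fin N) (Fin N) ℝ) (hM : ContinuousOn M (Icc (0:ℝ) 1))
    (hMpd : ∀ τ ∈ Icc (0:ℝ) 1, (M τ).PosDef)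
    (b : ℝ → Fin N → ℝ) (hb : ContinuousOn b (Icc (0:ℝ) 1))
    (c : ℝ → ℝ) (hc : ContinuousOn c (Icc (0:ℝ) 1))
    (g₂ : ℝ → ℝ)
    (hg₂ : ∀ τ, g₂ τ = (1 / 2) * (c τ - b τ ⬝ᵥ ((M τ)⁻¹ *ᵥ b τ)))
    (hg₂pos : ∀ τ ∈ Icc (0:ℝ) 1, 0 < g₂ τ) :
    ∀ (ξ : ℝ → Fin N → ℝ), ContinuousOn ξ (Icc (0:ℝ) 1) →
    ∀ τ : ℝ → ℝ, ContDiff ℝ 1 τ → MonotoneOn τ (Icc (0:ℝ) 1) →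
      τ 0 = 0 → τ 1 = 1 → (∀ t ∈ Icc (0:ℝ) 1, τ t ∈ Icc (0:ℝ) 1) →
      (∫ σ in (0:ℝ)..1, Real.sqrt (g₂ σ)) ^ 2 ≤
        ∫ t in (0:ℝ)..1,
          ((1 / 2) * (ξ t ⬝ᵥ (M (τ t) *ᵥ ξ t)) -
            (ξ t ⬝ᵥ b (τ t)) * deriv τ t +
            (1 / 2) * c (τ t) * (deriv τ t) ^ 2) := by
  intro ξ hξ τ hτ _ hτ0 hτ1 hmaps
  have hg : ContinuousOn g₂ (Icc (0:ℝ) 1) := by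
    rw [funext hg₂]
    exact continuousOn_const.mul (hc.sub (continuousOn_dotProduct_mulVec
      (continuousOn_matrix_inv hM fun x hx => (hMpd x hx).det_pos.ne') hb hb))
  have hsqrt : ContinuousOn (fun σ => Real.sqrt (g₂ σ)) (Icc (0:ℝ) 1) := hg.sqrt
  have hτc : ContinuousOn τ (Icc (0:ℝ) 1) := hτ.continuous.continuousOn
  have hdτ : ContinuousOn (deriv τ) (Icc (0:ℝ) 1) := hτ.continuous_deriv_one.continuousOn
  have hspeed : ContinuousOn (fun t => Real.sqrt (g₂ (τ t)) * deriv τ t) (Icc (0:ℝ) 1) :=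
    (hsqrt.comp hτc hmaps).mul hdτ
  have hcost : ContinuousOn (fun t => (1 / 2) * (ξ t ⬝ᵥ (M (τ t) *ᵥ ξ t)) -
      (ξ t ⬝ᵥ b (τ t)) * deriv τ t + (1 / 2) * c (τ t) * (deriv τ t) ^ 2) (Icc (0:ℝ) 1) := by
    have hbτ := hb.comp hτc hmaps
    have hξb : ContinuousOn (fun t => ξ t ⬝ᵥ b (τ t)) (Icc (0:ℝ) 1) := by
      rw [continuousOn_iff_continuous_domRestrict] at hξ hbτ ⊢
      exact hξ.dotProduct hbτ
    exact ((continuousOn_const.mul (continuousOn_dotProduct_mulVec (hM.comp hτc hmaps)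
      hξ hξ)).sub (hξb.mul hdτ)).add
        ((continuousOn_const.mul (hc.comp hτc hmaps)).mul (hdτ.pow 2))
  have hsubst : ∫ t in (0:ℝ)..1, Real.sqrt (g₂ (τ t)) * deriv τ t =
      ∫ σ in (0:ℝ)..1, Real.sqrt (g₂ σ) := by
    have himage : τ '' uIcc (0:ℝ) 1 ⊆ Icc (0:ℝ) 1 := by
      rw [uIcc_of_le zero_le_one]
      exact image_subset_iff.mpr hmaps
    have h := integral_comp_mul_deriv'' (a := 0) (b := 1) (f := τ) (f' := deriv τ)
      (g := fun σ => Real.sqrt (g₂ σ)) hτ.continuous.continuousOn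
      (fun x _ => ((hτ.differentiable one_ne_zero) x).hasDerivAt.hasDerivWithinAt)
      hτ.continuous_deriv_one.continuousOn (hsqrt.mono himage)
    simpa only [Function.comp_apply, hτ0, hτ1] using h
  set L := ∫ σ in (0:ℝ)..1, Real.sqrt (g₂ σ)
  have hspeed_int := hspeed.intervalIntegrable_of_Icc (μ := MeasureTheory.volume) zero_le_one
  have htangent : ∫ t in (0:ℝ)..1, (2 * L * (Real.sqrt (g₂ (τ t)) * deriv τ t) - L ^ 2) =
      L ^ 2 := by
    rw [integral_sub (hspeed_int.const_mul _) intervalIntegrable_const,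
      integral_const_mul, hsubst, integral_const]
    simp only [sub_zero, one_smul]
    ring
  rw [← htangent]
  refine integral_mono_on zero_le_one
    ((hspeed_int.const_mul _).sub intervalIntegrable_const)
    (hcost.intervalIntegrable_of_Icc zero_le_one) fun t ht => ?_
  have hpoint := quadratic_completion_le (hMpd _ (hmaps t ht)) (ξ t) (b (τ t)) (c (τ t))
    (deriv τ t)
  rw [← hg₂, ← Real.sq_sqrt (hg₂pos _ (hmaps t ht)).le] at hpoint
  nlinarith [sq_nonneg (Real.sqrt (g₂ (τ t)) * deriv τ t - L)]
end

section
/- Let N be a positive integer, let M : [0,1] → (N × N real matrices) be continuous with M(τ) symmetric positive definite for every τ ∈ [0,1], let b : [0,1] → ℝᴺ and c : [0,1] → ℝ be continuous, define 𝔤₂(τ) = ½ (c(τ) − b(τ)ᵀ M(τ)⁻¹ b(τ)), and assume 𝔤₂(τ) > 0 for all τ ∈ [0,1]. Set C = ∫₀¹ √(𝔤₂(σ)) dσ, and suppose τ₂* : [0,1] → ℝ is differentiable with τ₂*(0) = 0, τ₂*(1) = 1, τ₂*(t) ∈ [0,1] for all t, and (dτ₂*/dt)(t) = C / √(𝔤₂(τ₂*(t)))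 for all t ∈ [0,1]. Define ξ*(t) = (dτ₂*/dt)(t) · M(τ₂*(t))⁻¹ b(τ₂*(t)). Then ∫₀¹ { ½ ξ*(t)ᵀ M(τ₂*(t)) ξ*(t) − ξ*(t)ᵀ b(τ₂*(t)) (dτ₂*/dt)(t) + ½ c(τ₂*(t)) (dτ₂*/dt)(t)² } dt = (∫₀¹ √(𝔤₂(σ)) dσ)², so the lower bound of the joint minimization is attained at (ξ*, τ₂*). -/
open Set Matrix intervalIntegral

/-- At the optimal velocity `d • A⁻¹ *ᵥ v`, the quadratic cost reduces to `d ^ 2` times half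
the Schur complement `γ - v ⬝ᵥ (A⁻¹ *ᵥ v)`. -/
theorem quadratic_cost_at_optimal_velocity {n : Type*} [Fintype n] [DecidableEq n]
    {A : Matrix n n ℝ} (hA : IsUnit A.det) (v : n → ℝ) (γ d : ℝ) :
    (1 / 2) * ((d • (A⁻¹ *ᵥ v)) ⬝ᵥ (A *ᵥ (d • (A⁻¹ *ᵥ v)))) -
        ((d • (A⁻¹ *ᵥ v)) ⬝ᵥ v) * d + (1 / 2) * γ * d ^ 2 =
      (1 / 2) * (γ - v ⬝ᵥ (A⁻¹ *ᵥ v)) * d ^ 2 := by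
  have hv : A *ᵥ (A⁻¹ *ᵥ v) = v := by
    rw [mulVec_mulVec, mul_nonsing_inv A hA, one_mulVec]
  rw [mulVec_smul, hv, dotProduct_comm v]
  simp only [smul_dotProduct, dotProduct_smul, smul_eq_mul]
  ring

/-- The lower bound `(∫₀¹ √(𝔤₂ σ) dσ)²` of the joint
minimization is attained: substituting the pointwise optimal velocity
`ξ*(t) = τ̇₂*(t) · M(τ₂*(t))⁻¹ b(τ₂*(t))` along the optimal time
reparameterization `τ₂*` (which solves `τ̇ = C / √(𝔤₂ τ)` with
`C = ∫₀¹ √(𝔤₂ σ) dσ`, `τ₂* 0 = 0`, `τ₂* 1 = 1`) makes the joint cost equal to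
`(∫₀¹ √(𝔤₂ σ) dσ)²`. -/
theorem joint_minimization_lower_bound_attained
    (N : ℕ) (hN : 0 < N)
    (M : ℝ → Matrix (Fin N) (Fin N) ℝ) (hM : ContinuousOn M (Icc (0:ℝ) 1))
    (hMpd : ∀ τ ∈ Icc (0:ℝ) 1, (M τ).PosDef)
    (b : ℝ → Fin N → ℝ) (hb : ContinuousOn b (Icc (0:ℝ) 1))
    (c : ℝ → ℝ) (hc : ContinuousOn c (Icc (0:ℝ) 1))
    (g₂ : ℝ → ℝ)
    (hg₂ : ∀ τ, g₂ τ = (1 / 2) * (c τ - b τ ⬝ᵥ ((M τ)⁻¹ *ᵥ b τ)))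
    (hg₂pos : ∀ τ ∈ Icc (0:ℝ) 1, 0 < g₂ τ)
    (C : ℝ) (hC : C = ∫ σ in (0:ℝ)..1, Real.sqrt (g₂ σ))
    (τs : ℝ → ℝ)
    (hτdiff : ∀ t ∈ Icc (0:ℝ) 1, DifferentiableAt ℝ τs t)
    (hτ0 : τs 0 = 0) (hτ1 : τs 1 = 1)
    (hτmem : ∀ t ∈ Icc (0:ℝ) 1, τs t ∈ Icc (0:ℝ) 1)
    (hode : ∀ t ∈ Icc (0:ℝ) 1, deriv τs t = C / Real.sqrt (g₂ (τs t)))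
    (ξs : ℝ → Fin N → ℝ)
    (hξs : ∀ t, ξs t = deriv τs t • ((M (τs t))⁻¹ *ᵥ b (τs t))) :
    (∫ t in (0:ℝ)..1,
        ((1 / 2) * (ξs t ⬝ᵥ (M (τs t) *ᵥ ξs t)) -
          (ξs t ⬝ᵥ b (τs t)) * deriv τs t +
          (1 / 2) * c (τs t) * (deriv τs t) ^ 2)) =
      (∫ σ in (0:ℝ)..1, Real.sqrt (g₂ σ)) ^ 2 := by
  rw [← hC]
  have hcost : ∀ t ∈ uIcc (0:ℝ) 1,
      (1 / 2) * (ξs t ⬝ᵥ (M (τs t) *ᵥ ξs t)) - (ξs t ⬝ᵥ b (τs t)) * deriv τs t +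
        (1 / 2) * c (τs t) * (deriv τs t) ^ 2 = C ^ 2 := by
    intro t ht
    rw [uIcc_of_le zero_le_one] at ht
    have hpos := hg₂pos _ (hτmem t ht)
    rw [hξs, quadratic_cost_at_optimal_velocity (hMpd _ (hτmem t ht)).det_pos.ne'.isUnit,
      ← hg₂, hode t ht, div_pow, Real.sq_sqrt hpos.le]
    field_simp
  rw [integral_congr hcost]
  simp
end
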